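/- arXiv:1506.07509 — 2 statements merged into one kernel-verified Lean document; each statement's English description precedes it below -/
import Mathlib

section
/- Let n ≥ m ≥ 1 be integers, ν, k reals with ν/2 + k > 0, and τ = (t_1,…,t_m) ∈ ℝ^m with t_1 ≥ … ≥ t_m and n/2 > (m−1)/2 − t_m. Then ∫_{{R ∈ ℝ^{n×m} : tr(RᵀR) < 1}} (1 − tr(RᵀR))^{ν/2+k−1} q_τ(RᵀR) dR = π^{mn/2} Γ_m(n/2, τ) Γ(ν/2 + k) / (Γ_m(n/2) Γ((ν+mn)/2 + k + Σ_{i=1}^m t_i)); that is, the standardized matrix multivariate Pearson type II-Riesz density integrates to one. -/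
open MeasureTheory Matrix Real

instance matMeasurableSpace {n m : ℕ} {α : Type*} [MeasurableSpace α] :
    MeasurableSpace (Matrix (Fin n) (Fin m) α) :=
  inferInstanceAs (MeasurableSpace (Fin n → Fin m → α))

noncomputable instance matMeasureSpace {n m : ℕ} {α : Type*} [MeasureSpace α]
    [SigmaFinite (volume : Measure α)] : MeasureSpace (Matrix (Fin n) (Fin m) α) :=
  inferInstanceAs (MeasureSpace (Fin n → Fin m → α))

/-- Determinant of the leading principal `i × i` submatrix. -/
noncomputable def leadMinor {m : ℕ} (A : Matrix (Fin m) (Fin m) ℝ) (i : ℕ) : ℝ :=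
  if h : i ≤ m then (A.submatrix (Fin.castLE h) (Fin.castLE h)).det else 0

/-- Highest weight vector `q_τ(A) = det(A)^{t_m} ∏_{i=1}^{m−1} det(A_i)^{t_i − t_{i+1}}`. -/
noncomputable def hwVector {m : ℕ} (τ : Fin m → ℝ) (A : Matrix (Fin m) (Fin m) ℝ) : ℝ :=
  ∏ i : Fin m,
    leadMinor A ((i : ℕ) + 1) ^ (τ i - if h : (i : ℕ) + 1 < m then τ ⟨(i : ℕ) + 1, h⟩ else 0)

/-- Real multivariate gamma function `Γ_m(a)`. -/
noncomputable def mvGamma (m : ℕ) (a : ℝ) : ℝ :=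
  π ^ ((m : ℝ) * ((m : ℝ) - 1) / 4) * ∏ i : Fin m, Gamma (a - (i : ℝ) / 2)

/-- Generalized gamma function of weight `τ`, `Γ_m(a, τ)`. -/
noncomputable def mvGammaW {m : ℕ} (a : ℝ) (τ : Fin m → ℝ) : ℝ :=
  π ^ ((m : ℝ) * ((m : ℝ) - 1) / 4) * ∏ i : Fin m, Gamma (a + τ i - (i : ℝ) / 2)

theorem leadMinor_submatrix_castSucc {m : ℕ} (A : Matrix (Fin (m + 1)) (Fin (m + 1)) ℝ) {i : ℕ}
    (hi : i ≤ m) : leadMinor (A.submatrix Fin.castSucc Fin.castSucc) i = leadMinor A i := by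
  rw [leadMinor, leadMinor, dif_pos hi, dif_pos (hi.trans m.le_succ)]
  rfl

theorem leadMinor_self {m : ℕ} (A : Matrix (Fin m) (Fin m) ℝ) : leadMinor A m = A.det := by
  rw [leadMinor, dif_pos le_rfl]
  rfl

theorem hwVector_succ {m : ℕ} (τ : Fin (m + 1) → ℝ) (A : Matrix (Fin (m + 1)) (Fin (m + 1)) ℝ)
    {D : ℝ} (hD : 0 ≤ D) (hpos : 0 < (A.submatrix Fin.castSucc Fin.castSucc).det)
    (hdet : A.det = (A.submatrix Fin.castSucc Fin.castSucc).det * D) :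
    hwVector τ A =
      hwVector (τ ∘ Fin.castSucc) (A.submatrix Fin.castSucc Fin.castSucc) *
        D ^ τ (Fin.last m) := by
  cases m with
  | zero =>
    have h : A.det = D := by rw [hdet, det_isEmpty, one_mul]
    have h1 : leadMinor A 1 = D := by rw [← h, leadMinor_self A]
    simp [hwVector, h1]
  | succ m =>
    have h1 : leadMinor A (m + 1) = (A.submatrix Fin.castSucc Fin.castSucc).det := by
      rw [← leadMinor_submatrix_castSucc A le_rfl, leadMinor_self]
    have h2 : leadMinor A (m + 2) = (A.submatrix Fin.castSucc Fin.castSucc).det * D := by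
      rw [leadMinor_self, hdet]
    have h6 := leadMinor_self (A.submatrix (Fin.castSucc (n := m + 1)) Fin.castSucc)
    have h3 : (⟨m + 1, by omega⟩ : Fin (m + 2)) = Fin.last (m + 1) := rfl
    rw [hwVector, Fin.prod_univ_castSucc, Fin.prod_univ_castSucc, hwVector,
      Fin.prod_univ_castSucc]
    have h4 : ∀ i : Fin m, leadMinor (A.submatrix Fin.castSucc Fin.castSucc) ((i : ℕ) + 1) =
        leadMinor A ((i : ℕ) + 1) := fun i =>
      leadMinor_submatrix_castSucc A (by omega)
    have h5 : ∀ i : Fin m, (i : ℕ) + 1 < m + 1 + 1 := fun i => by omega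
    simp only [Fin.val_castSucc, Fin.val_last, h4, h6, h1, h2, h3, Function.comp_apply,
      lt_irrefl, dite_false, sub_zero, Nat.lt_succ_self, dite_true, h5, Nat.succ_lt_succ_iff,
      Fin.is_lt, Fin.castSucc_mk]
    rw [mul_rpow hpos.le hD, rpow_sub hpos]
    have := (rpow_pos_of_pos hpos (τ (Fin.last (m + 1)))).ne'
    field_simp

theorem sum_range_succ_mul_sub (T : ℕ → ℝ) (m : ℕ) :
    ∑ i ∈ Finset.range m, ((i : ℝ) + 1) * (T i - T (i + 1)) =
      ∑ i ∈ Finset.range m, T i - m * T m := by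
  induction m with
  | zero => simp
  | succ m ih => rw [Finset.sum_range_succ, Finset.sum_range_succ, ih]; push_cast; ring

theorem leadMinor_smul {m : ℕ} (A : Matrix (Fin m) (Fin m) ℝ) (c : ℝ) (i : ℕ) :
    leadMinor (c • A) i = c ^ i * leadMinor A i := by
  unfold leadMinor
  split_ifs with h
  · have := det_smul (A.submatrix (Fin.castLE h) (Fin.castLE h)) c
    rw [Fintype.card_fin] at this
    exact this
  · simp

theorem leadMinor_nonneg {m : ℕ} {A : Matrix (Fin m) (Fin m) ℝ} (hA : A.PosSemidef) (i : ℕ) :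
    0 ≤ leadMinor A i := by
  unfold leadMinor
  split_ifs with h
  · exact (hA.submatrix _).det_nonneg
  · exact le_rfl

theorem hwVector_nonneg {m : ℕ} (τ : Fin m → ℝ) {A : Matrix (Fin m) (Fin m) ℝ}
    (hA : A.PosSemidef) : 0 ≤ hwVector τ A :=
  Finset.prod_nonneg fun _ _ => rpow_nonneg (leadMinor_nonneg hA _) _

theorem hwVector_smul {m : ℕ} (τ : Fin m → ℝ) {A : Matrix (Fin m) (Fin m) ℝ}
    (hA : A.PosSemidef) {c : ℝ} (hc : 0 < c) :
    hwVector τ (c • A) = c ^ (∑ i, τ i) * hwVector τ A := by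
  have hsum : ∑ i : Fin m, ((i : ℝ) + 1) *
      (τ i - if h : (i : ℕ) + 1 < m then τ ⟨(i : ℕ) + 1, h⟩ else 0) = ∑ i, τ i := by
    have := sum_range_succ_mul_sub (fun j => if h : j < m then τ ⟨j, h⟩ else 0) m
    simpa [Finset.sum_range] using this
  unfold hwVector
  rw [← hsum, rpow_sum_of_pos hc, ← Finset.prod_mul_distrib]
  refine Finset.prod_congr rfl fun i _ => ?_
  rw [leadMinor_smul, mul_rpow (by positivity) (leadMinor_nonneg hA _), ← rpow_natCast,
    ← rpow_mul hc.le]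
  push_cast
  rfl

theorem gram_snoc_submatrix {E : Type*} [NormedAddCommGroup E] [InnerProductSpace ℝ E] {m : ℕ}
    (v : Fin m → E) (x : E) :
    (gram ℝ (Fin.snoc v x : Fin (m + 1) → E)).submatrix Fin.castSucc Fin.castSucc = gram ℝ v := by
  ext i j
  simp [gram_apply]

theorem det_gram_snoc {E : Type*} [NormedAddCommGroup E] [InnerProductSpace ℝ E] {m : ℕ}
    (v : Fin m → E) (x : E) [(Submodule.span ℝ (Set.range v)).HasOrthogonalProjection] :
    (gram ℝ (Fin.snoc v x : Fin (m + 1) → E)).det =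
      (gram ℝ v).det * ‖(Submodule.span ℝ (Set.range v))ᗮ.orthogonalProjectionOnto x‖ ^ 2 := by
  set V := Submodule.span ℝ (Set.range v) with hV
  set w : E := (Vᗮ.orthogonalProjectionOnto x : E) with hw
  obtain ⟨c, hc⟩ := (Submodule.mem_span_range_iff_exists_fun ℝ).1
    (V.orthogonalProjectionOnto x).2
  have hx : x = ∑ i, c i • v i + w := by
    rw [hc, hw]
    exact (V.starProjection_add_starProjection_orthogonal x).symm
  have hwv : ∀ i, inner ℝ w (v i) = 0 := fun i =>
    Submodule.inner_left_of_mem_orthogonal (K := V) (Submodule.subset_span (Set.mem_range_self i))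
      (Vᗮ.orthogonalProjectionOnto x).2
  have hwx : inner ℝ w x = ‖w‖ ^ 2 := by
    rw [hx, inner_add_right, inner_sum]
    simp [inner_smul_right, hwv]
  set G := gram ℝ (Fin.snoc v x : Fin (m + 1) → E) with hG
  set B := G.updateRow (Fin.last m) (Fin.snoc (fun _ => 0) (‖w‖ ^ 2)) with hB
  have hGB : G = B.updateRow (Fin.last m)
      (∑ k, (Fin.snoc c 1 : Fin (m + 1) → ℝ) k • B k) := by
    ext i j
    refine Fin.lastCases ?_ (fun i => ?_) i
    · rw [updateRow_self, Fin.sum_univ_castSucc]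
      simp only [Fin.snoc_castSucc, Fin.snoc_last, one_smul, Pi.add_apply, Finset.sum_apply,
        Pi.smul_apply, hB, updateRow_self, smul_eq_mul]
      simp only [updateRow_ne (Fin.castSucc_lt_last _).ne, hG, gram_apply, Fin.snoc_last,
        Fin.snoc_castSucc]
      have h1 : ∀ y : E, inner ℝ x y = ∑ i, c i * inner ℝ (v i) y + inner ℝ w y := fun y => by
        conv_lhs => rw [hx]
        rw [inner_add_left, sum_inner]
        simp [inner_smul_left]
      refine Fin.lastCases ?_ (fun j => ?_) j
      · simp only [Fin.snoc_last]
        rw [h1, hwx]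
      · simp only [Fin.snoc_castSucc]
        rw [h1, hwv]
    · rw [updateRow_ne (Fin.castSucc_lt_last _).ne, hB, updateRow_ne (Fin.castSucc_lt_last _).ne]
  have hdet : G.det = B.det := by
    conv_lhs => rw [hGB, det_updateRow_sum]
    simp
  rw [hdet, det_succ_row B (Fin.last m), Fin.sum_univ_castSucc]
  have h0 : ∀ j : Fin m, B (Fin.last m) j.castSucc = 0 := fun j => by simp [hB]
  have h1 : B (Fin.last m) (Fin.last m) = ‖w‖ ^ 2 := by simp [hB]
  have h2 : B.submatrix (Fin.last m).succAbove (Fin.last m).succAbove = gram ℝ v := by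
    ext i j
    simp [hB, hG, gram_apply]
  simp only [h0, h1, h2, mul_zero, zero_mul, Finset.sum_const_zero, zero_add]
  rw [Even.neg_one_pow (by simp), one_mul, mul_comm]
  rfl

theorem hwVector_gram_snoc {E : Type*} [NormedAddCommGroup E] [InnerProductSpace ℝ E] {m : ℕ}
    (τ : Fin (m + 1) → ℝ) {v : Fin m → E} (hv : LinearIndependent ℝ v) (x : E)
    [(Submodule.span ℝ (Set.range v)).HasOrthogonalProjection] :
    hwVector τ (gram ℝ (Fin.snoc v x : Fin (m + 1) → E)) =
      hwVector (τ ∘ Fin.castSucc) (gram ℝ v) *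
        (‖(Submodule.span ℝ (Set.range v))ᗮ.orthogonalProjectionOnto x‖ ^ 2) ^
          τ (Fin.last m) := by
  have h := hwVector_succ τ (gram ℝ (Fin.snoc v x : Fin (m + 1) → E)) (sq_nonneg _)
    (by rw [gram_snoc_submatrix]; exact (posDef_gram_of_linearIndependent hv).det_pos)
    (by rw [gram_snoc_submatrix]; exact det_gram_snoc v x)
  rwa [gram_snoc_submatrix] at h

theorem lintegral_ofReal_of_integral_pos {α : Type*} [MeasurableSpace α] {μ : Measure α}
    {f : α → ℝ} (hf : 0 ≤ f) (h : 0 < ∫ x, f x ∂μ) :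
    ∫⁻ x, ENNReal.ofReal (f x) ∂μ = ENNReal.ofReal (∫ x, f x ∂μ) :=
  (ofReal_integral_eq_lintegral_ofReal (Integrable.of_integral_ne_zero h.ne')
    (Filter.Eventually.of_forall hf)).symm

section Gaussian

variable {F : Type*} [NormedAddCommGroup F] [InnerProductSpace ℝ F] [FiniteDimensional ℝ F]
  [MeasurableSpace F] [BorelSpace F]

theorem lintegral_exp_neg_norm_sq :
    ∫⁻ x : F, ENNReal.ofReal (exp (-‖x‖ ^ 2)) =
      ENNReal.ofReal (π ^ ((Module.finrank ℝ F : ℝ) / 2)) := by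
  have h : ∫ x : F, exp (-‖x‖ ^ 2) = π ^ ((Module.finrank ℝ F : ℝ) / 2) := by
    simpa using GaussianFourier.integral_rexp_neg_mul_sq_norm (V := F) one_pos
  rw [← h, lintegral_ofReal_of_integral_pos (fun x => (exp_pos _).le)]
  rw [h]
  positivity

theorem lintegral_exp_neg_norm_sq_mul_rpow [Nontrivial F] {t : ℝ}
    (ht : 0 < (Module.finrank ℝ F : ℝ) / 2 + t) :
    ∫⁻ x : F, ENNReal.ofReal (exp (-‖x‖ ^ 2) * (‖x‖ ^ 2) ^ t) =
      ENNReal.ofReal (π ^ ((Module.finrank ℝ F : ℝ) / 2) *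
        Gamma ((Module.finrank ℝ F : ℝ) / 2 + t) / Gamma ((Module.finrank ℝ F : ℝ) / 2)) := by
  have hd : 0 < Module.finrank ℝ F := Module.finrank_pos
  set d := Module.finrank ℝ F with hd_def
  have hd' : (0 : ℝ) < d := by exact_mod_cast hd
  have hI : ∫ y in Set.Ioi (0 : ℝ), y ^ (d - 1) • (exp (-y ^ 2) * (y ^ 2) ^ t) =
      Gamma ((d : ℝ) / 2 + t) / 2 := by
    have := integral_rpow_mul_exp_neg_rpow (p := 2) (q := d - 1 + 2 * t) two_pos (by linarith)
    rw [show ((d : ℝ) - 1 + 2 * t + 1) / 2 = d / 2 + t by ring] at this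
    rw [div_eq_inv_mul, ← one_div, ← this]
    refine setIntegral_congr_fun measurableSet_Ioi fun y hy => ?_
    have hy : (0 : ℝ) < y := hy
    have h1 : (y ^ 2) ^ t = y ^ (2 * t) := by
      rw [← rpow_natCast, ← rpow_mul hy.le]; norm_num
    have h2 : y ^ (d - 1) = y ^ ((d : ℝ) - 1) := by
      rw [← rpow_natCast, Nat.cast_sub hd]; norm_num
    simp only [smul_eq_mul]
    rw [h1, h2, rpow_add hy, rpow_two]
    ring
  have h : ∫ x : F, exp (-‖x‖ ^ 2) * (‖x‖ ^ 2) ^ t = π ^ ((d : ℝ) / 2) *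
      Gamma ((d : ℝ) / 2 + t) / Gamma ((d : ℝ) / 2) := by
    rw [integral_fun_norm_addHaar volume (fun y => exp (-y ^ 2) * (y ^ 2) ^ t), hI, measureReal_def,
      InnerProductSpace.volume_ball, ENNReal.ofReal_one, one_pow, one_mul, ENNReal.toReal_ofReal,
      Gamma_add_one (by positivity), sqrt_eq_rpow, ← rpow_natCast, ← rpow_mul pi_pos.le, ← hd_def]
    · have := (Gamma_pos_of_pos (half_pos hd')).ne'
      simp only [nsmul_eq_mul, smul_eq_mul]
      rw [show 1 / 2 * (d : ℝ) = d / 2 by ring]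
      field_simp
    · have := Gamma_pos_of_pos (show 0 < (d : ℝ) / 2 + 1 by positivity)
      positivity
  rw [← h, lintegral_ofReal_of_integral_pos
    (fun x => mul_nonneg (exp_pos _).le (rpow_nonneg (sq_nonneg _) _))]
  rw [h]
  have := Gamma_pos_of_pos ht
  have := Gamma_pos_of_pos (half_pos hd')
  positivity

theorem lintegral_exp_neg_norm_sq_mul_orthogonal_rpow (V : Submodule ℝ F) {t : ℝ}
    (hV : V ≠ ⊤)
    (ht : 0 < ((Module.finrank ℝ F : ℝ) - Module.finrank ℝ V) / 2 + t) :
    ∫⁻ x : F, ENNReal.ofReal (exp (-‖x‖ ^ 2) * (‖Vᗮ.orthogonalProjectionOnto x‖ ^ 2) ^ t) =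
      ENNReal.ofReal (π ^ ((Module.finrank ℝ F : ℝ) / 2) *
        Gamma (((Module.finrank ℝ F : ℝ) - Module.finrank ℝ V) / 2 + t) /
          Gamma (((Module.finrank ℝ F : ℝ) - Module.finrank ℝ V) / 2)) := by
  have : Nontrivial Vᗮ := by
    rw [Submodule.nontrivial_iff_ne_bot]
    exact fun h => hV (Submodule.orthogonal_eq_bot_iff.1 h)
  have hdim : (Module.finrank ℝ F : ℝ) - Module.finrank ℝ V = Module.finrank ℝ Vᗮ := by
    rw [← V.finrank_add_finrank_orthogonal]; push_cast; ring
  have hdim' : (Module.finrank ℝ F : ℝ) = Module.finrank ℝ V + Module.finrank ℝ Vᗮ := by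
    linarith
  rw [hdim] at ht ⊢
  have hmp : MeasurePreserving (fun x : F => WithLp.ofLp (V.orthogonalDecomposition x)) :=
    (WithLp.volume_preserving_ofLp V Vᗮ).comp V.orthogonalDecomposition.measurePreserving
  have h1 : ∀ x : F, ENNReal.ofReal
      (exp (-‖x‖ ^ 2) * (‖Vᗮ.orthogonalProjectionOnto x‖ ^ 2) ^ t) =
      (fun p : V × Vᗮ => ENNReal.ofReal (exp (-‖p.1‖ ^ 2)) *
        ENNReal.ofReal (exp (-‖p.2‖ ^ 2) * (‖p.2‖ ^ 2) ^ t))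
        (WithLp.ofLp (V.orthogonalDecomposition x)) := fun x => by
    have hx : ‖x‖ ^ 2 = ‖V.orthogonalProjectionOnto x‖ ^ 2 +
        ‖Vᗮ.orthogonalProjectionOnto x‖ ^ 2 := by
      rw [← V.orthogonalDecomposition.norm_map x, WithLp.prod_norm_sq_eq_of_L2]
      simp
    have h2 : WithLp.ofLp (V.orthogonalDecomposition x) =
        (V.orthogonalProjectionOnto x, Vᗮ.orthogonalProjectionOnto x) := by
      rw [Submodule.orthogonalDecomposition_apply]
    rw [h2]
    dsimp only
    rw [← ENNReal.ofReal_mul (exp_pos _).le, ← mul_assoc, ← exp_add, hx, neg_add]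
  simp_rw [h1]
  rw [hmp.lintegral_comp (f := fun p : V × Vᗮ => ENNReal.ofReal (exp (-‖p.1‖ ^ 2)) *
        ENNReal.ofReal (exp (-‖p.2‖ ^ 2) * (‖p.2‖ ^ 2) ^ t)) (by fun_prop),
    Measure.volume_eq_prod, lintegral_prod_mul (f := fun u : V => ENNReal.ofReal (exp (-‖u‖ ^ 2)))
      (g := fun w : Vᗮ => ENNReal.ofReal (exp (-‖w‖ ^ 2) * (‖w‖ ^ 2) ^ t))
      (by fun_prop) (by fun_prop),
    lintegral_exp_neg_norm_sq, lintegral_exp_neg_norm_sq_mul_rpow ht,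
    ← ENNReal.ofReal_mul (by positivity), hdim', add_div, rpow_add pi_pos]
  congr 1
  ring

end Gaussian

theorem volume_preserving_curry (ι κ X : Type*) [Fintype ι] [Fintype κ] [MeasureSpace X]
    [SigmaFinite (volume : Measure X)] : MeasurePreserving (MeasurableEquiv.curry ι κ X) := by
  refine MeasurePreserving.symm (MeasurableEquiv.curry ι κ X).symm
    ⟨MeasurableEquiv.measurable _, (Measure.pi_eq fun s hs => ?_).symm⟩
  rw [MeasurableEquiv.map_apply]
  have : (MeasurableEquiv.curry ι κ X).symm ⁻¹' Set.univ.pi s =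
      Set.univ.pi fun i => Set.univ.pi fun j => s (i, j) := by
    ext f
    simp [Set.mem_pi, MeasurableEquiv.coe_curry_symm]
  rw [this, volume_pi_pi, Fintype.prod_prod_type]
  simp_rw [volume_pi_pi]

theorem volume_preserving_swap (ι κ X : Type*) [Fintype ι] [Fintype κ] [MeasureSpace X]
    [SigmaFinite (volume : Measure X)] :
    MeasurePreserving (fun (f : ι → κ → X) (j : κ) (i : ι) => f i j) := by
  have h : MeasurePreserving (fun (f : ι → κ → X) (p : κ × ι) => f p.2 p.1) := by
    refine ⟨by fun_prop, (Measure.pi_eq fun s hs => ?_).symm⟩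
    rw [Measure.map_apply (by fun_prop) (MeasurableSet.univ_pi hs)]
    have : (fun (f : ι → κ → X) (p : κ × ι) => f p.2 p.1) ⁻¹' Set.univ.pi s =
        Set.univ.pi fun i => Set.univ.pi fun j => s (j, i) := by
      ext f
      simp only [Set.mem_preimage, Set.mem_pi, Set.mem_univ, true_imp_iff, Prod.forall]
      exact forall_comm
    rw [this, volume_pi_pi, Fintype.prod_prod_type_right]
    simp_rw [volume_pi_pi]
  exact (volume_preserving_curry κ ι X).comp h

theorem lintegral_Gamma {a : ℝ} (ha : 0 < a) :
    ∫⁻ y in Set.Ioi 0, ENNReal.ofReal (exp (-y) * y ^ (a - 1)) = ENNReal.ofReal (Gamma a) := by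
  rw [Gamma_eq_integral ha, ofReal_integral_eq_lintegral_ofReal (GammaIntegral_convergent ha)]
  filter_upwards [ae_restrict_mem measurableSet_Ioi] with y hy
  exact mul_nonneg (exp_pos _).le (rpow_nonneg (le_of_lt hy) _)

section Homogeneous

variable {X : Type*} [NormedAddCommGroup X] [NormedSpace ℝ X] [FiniteDimensional ℝ X]
  [MeasurableSpace X] [BorelSpace X] (μ : Measure X) [μ.IsAddHaarMeasure]

theorem lintegral_eq_lintegral_comp_smul {g : X → ENNReal} (hg : Measurable g) {c : ℝ}
    (hc : 0 < c) :
    ∫⁻ x, g x ∂μ = ENNReal.ofReal (c ^ Module.finrank ℝ X) * ∫⁻ x, g (c • x) ∂μ := by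
  rw [← lintegral_map hg (measurable_const_smul c), Measure.map_addHaar_smul μ hc.ne',
    lintegral_smul_measure, smul_eq_mul, ← mul_assoc, ← ENNReal.ofReal_mul (by positivity),
    abs_of_pos (by positivity), mul_inv_cancel₀ (by positivity), ENNReal.ofReal_one, one_mul]

theorem lintegral_ball_of_homogeneous {Q : X → ℝ} (hQm : Measurable Q) (hQ : ∀ x, 0 ≤ Q x)
    (hQs : ∀ (c : ℝ) (x : X), 0 < c → Q (c • x) = c ^ 2 * Q x) {f : X → ENNReal}
    (hfm : Measurable f) {s : ℝ}
    (hfs : ∀ (c : ℝ) (x : X), 0 < c → f (c • x) = ENNReal.ofReal (c ^ (2 * s)) * f x) {a : ℝ}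
    (ha : 0 < a) (hb : 0 < (Module.finrank ℝ X : ℝ) / 2 + s + a) :
    ENNReal.ofReal (Gamma a) * ∫⁻ x, ENNReal.ofReal (exp (-Q x)) * f x ∂μ =
      ENNReal.ofReal (Gamma ((Module.finrank ℝ X : ℝ) / 2 + s + a)) *
        ∫⁻ x in {x | Q x < 1}, ENNReal.ofReal ((1 - Q x) ^ (a - 1)) * f x ∂μ := by
  set b := (Module.finrank ℝ X : ℝ) / 2 + s + a with hb_def
  set h : ℝ → ENNReal := (Set.Ioi 0).indicator fun u => ENNReal.ofReal (u ^ (a - 1)) with hh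
  have hm : Measurable h := Measurable.indicator (by fun_prop) measurableSet_Ioi
  have hscale : ∀ w u : ℝ, 0 < w → h (w * u) = ENNReal.ofReal (w ^ (a - 1)) * h u := by
    intro w u hw
    by_cases hu : 0 < u
    · rw [hh, Set.indicator_of_mem (show w * u ∈ Set.Ioi 0 from mul_pos hw hu),
        Set.indicator_of_mem (show u ∈ Set.Ioi 0 from hu), mul_rpow hw.le hu.le,
        ENNReal.ofReal_mul (by positivity)]
    · rw [hh, Set.indicator_of_notMem (show w * u ∉ Set.Ioi 0 from
          fun h => hu (pos_of_mul_pos_right h hw.le)),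
        Set.indicator_of_notMem (show u ∉ Set.Ioi 0 from hu), mul_zero]
  have hball : ∫⁻ x in {x | Q x < 1}, ENNReal.ofReal ((1 - Q x) ^ (a - 1)) * f x ∂μ =
      ∫⁻ x, h (1 - Q x) * f x ∂μ := by
    rw [← lintegral_indicator (measurableSet_lt hQm measurable_const)]
    refine lintegral_congr fun x => ?_
    by_cases hx : Q x < 1
    · rw [Set.indicator_of_mem (show x ∈ {x | Q x < 1} from hx), hh,
        Set.indicator_of_mem (show 1 - Q x ∈ Set.Ioi 0 from sub_pos.2 hx)]
    · rw [Set.indicator_of_notMem (show x ∉ {x | Q x < 1} from hx), hh,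
        Set.indicator_of_notMem (show 1 - Q x ∉ Set.Ioi 0 from fun h => hx (sub_pos.1 h)),
        zero_mul]
  have hleft : ∀ x, ∫⁻ w, ENNReal.ofReal (exp (-w)) * h (w - Q x) * f x =
      ENNReal.ofReal (Gamma a) * (ENNReal.ofReal (exp (-Q x)) * f x) := by
    intro x
    rw [← lintegral_add_right_eq_self _ (Q x), ← lintegral_Gamma ha,
      ← lintegral_indicator measurableSet_Ioi, ← lintegral_mul_const _
        (Measurable.indicator (by fun_prop) measurableSet_Ioi)]
    refine lintegral_congr fun y => ?_
    rw [add_sub_cancel_right, neg_add, exp_add, ENNReal.ofReal_mul (exp_pos _).le, hh]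
    by_cases hy : y ∈ Set.Ioi 0
    · rw [Set.indicator_of_mem hy, Set.indicator_of_mem hy, ENNReal.ofReal_mul (exp_pos _).le]
      ring
    · rw [Set.indicator_of_notMem hy, Set.indicator_of_notMem hy]
      simp
  have hright : ∀ w : ℝ, ∫⁻ x, ENNReal.ofReal (exp (-w)) * h (w - Q x) * f x ∂μ =
      (Set.Ioi 0).indicator (fun w => ENNReal.ofReal (exp (-w) * w ^ (b - 1))) w *
        ∫⁻ x, h (1 - Q x) * f x ∂μ := by
    intro w
    by_cases hw : 0 < w
    · rw [Set.indicator_of_mem (show w ∈ Set.Ioi 0 from hw),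
        lintegral_eq_lintegral_comp_smul μ (by fun_prop) (sqrt_pos.2 hw),
        ← lintegral_const_mul _ (by fun_prop), ← lintegral_const_mul _ (by fun_prop)]
      refine lintegral_congr fun x => ?_
      have h1 : w - w * Q x = w * (1 - Q x) := by ring
      have h2 : √w ^ (2 * s) = w ^ s := by
        rw [sqrt_eq_rpow, ← rpow_mul hw.le]; congr 1; ring
      have h3 : √w ^ Module.finrank ℝ X = w ^ ((Module.finrank ℝ X : ℝ) / 2) := by
        rw [sqrt_eq_rpow, ← rpow_natCast, ← rpow_mul hw.le]; congr 1; ring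
      have h4 : w ^ (b - 1) = w ^ ((Module.finrank ℝ X : ℝ) / 2) * w ^ s * w ^ (a - 1) := by
        rw [← rpow_add hw, ← rpow_add hw]; congr 1; rw [hb_def]; ring
      rw [hQs _ _ (sqrt_pos.2 hw), hfs _ _ (sqrt_pos.2 hw), sq_sqrt hw.le, h1, hscale _ _ hw, h2,
        h3, h4, ENNReal.ofReal_mul (exp_pos _).le, ENNReal.ofReal_mul (by positivity),
        ENNReal.ofReal_mul (by positivity)]
      ring
    · rw [Set.indicator_of_notMem (show w ∉ Set.Ioi 0 from hw), zero_mul]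
      refine lintegral_eq_zero_of_ae_eq_zero (Filter.Eventually.of_forall fun x => ?_)
      have : w - Q x ∉ Set.Ioi 0 := fun h => hw ((hQ x).trans_lt (sub_pos.1 h))
      simp [hh, Set.indicator_of_notMem this]
  rw [hball, ← lintegral_const_mul _ (by fun_prop), ← lintegral_Gamma hb,
    ← lintegral_indicator measurableSet_Ioi, ← lintegral_mul_const _
      (Measurable.indicator (by fun_prop) measurableSet_Ioi)]
  simp_rw [← hleft, ← hright]
  exact lintegral_lintegral_swap (by fun_prop)

end Homogeneous

theorem ae_linearIndependent {F : Type*} [NormedAddCommGroup F] [InnerProductSpace ℝ F]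
    [FiniteDimensional ℝ F] [MeasurableSpace F] [BorelSpace F] {m : ℕ}
    (hm : m ≤ Module.finrank ℝ F) : ∀ᵐ v : Fin m → F, LinearIndependent ℝ v := by
  induction m with
  | zero => exact Filter.Eventually.of_forall fun v => linearIndependent_empty_type
  | succ m ih =>
    have hmp := volume_preserving_piFinSuccAbove (fun _ : Fin (m + 1) => F) (Fin.last m)
    have hcont : Continuous fun p : F × (Fin m → F) => (Fin.snoc p.2 p.1 : Fin (m + 1) → F) := by
      fun_prop
    have hmeas : MeasurableSet {p : F × (Fin m → F) |
        LinearIndependent ℝ (Fin.snoc p.2 p.1 : Fin (m + 1) → F)} :=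
      (isOpen_setOfPred_linearIndependent.preimage hcont).measurableSet
    have key : ∀ᵐ p : F × (Fin m → F),
        LinearIndependent ℝ (Fin.snoc p.2 p.1 : Fin (m + 1) → F) := by
      rw [Measure.volume_eq_prod, Measure.ae_prod_iff_ae_ae hmeas, Measure.ae_ae_comm hmeas]
      filter_upwards [ih (by omega)] with v hv
      have hV : Submodule.span ℝ (Set.range v) ≠ ⊤ := fun h => by
        have := finrank_span_eq_card hv
        rw [h, finrank_top, Fintype.card_fin] at this
        omega
      have : ∀ᵐ x : F, x ∉ Submodule.span ℝ (Set.range v) :=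
        measure_eq_zero_iff_ae_notMem.1 (Measure.addHaar_submodule volume _ hV)
      filter_upwards [this] with x hx
      exact linearIndependent_finSnoc.2 ⟨hv, hx⟩
    filter_upwards [hmp.quasiMeasurePreserving.ae key] with v hv
    have : (Fin.snoc (fun j => v (Fin.castSucc j)) (v (Fin.last m)) : Fin (m + 1) → F) = v :=
      Fin.snoc_init_self v
    rw [← this]
    convert! hv using 2
    simp only [MeasurableEquiv.piFinSuccAbove, Fin.insertNthEquiv, MeasurableEquiv.coe_mk,
      Equiv.coe_fn_symm_mk, Fin.removeNth_last]
    rfl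

theorem measurable_hwVector_gram {F : Type*} [NormedAddCommGroup F] [InnerProductSpace ℝ F]
    [FiniteDimensional ℝ F] [MeasurableSpace F] [BorelSpace F] {m : ℕ} (τ : Fin m → ℝ) :
    Measurable fun v : Fin m → F => hwVector τ (gram ℝ v) := by
  have h : ∀ i, Continuous fun v : Fin m → F => leadMinor (gram ℝ v) i := fun i => by
    unfold leadMinor
    split_ifs
    · refine Continuous.matrix_det (continuous_matrix fun _ _ => ?_)
      simp only [submatrix_apply, gram_apply]
      fun_prop
    · exact continuous_const
  exact Finset.measurable_prod _ fun i _ => (h _).measurable.pow_const _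

theorem lintegral_gaussian_hwVector {F : Type*} [NormedAddCommGroup F] [InnerProductSpace ℝ F]
    [FiniteDimensional ℝ F] [MeasurableSpace F] [BorelSpace F] {m : ℕ}
    (hm : m ≤ Module.finrank ℝ F) (τ : Fin m → ℝ)
    (hτ : ∀ i : Fin m, 0 < ((Module.finrank ℝ F : ℝ) - (i : ℕ)) / 2 + τ i) :
    ∫⁻ v : Fin m → F,
        ENNReal.ofReal (exp (-∑ i, ‖v i‖ ^ 2)) * ENNReal.ofReal (hwVector τ (gram ℝ v)) =
      ENNReal.ofReal (∏ i : Fin m, (π ^ ((Module.finrank ℝ F : ℝ) / 2) *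
        Gamma (((Module.finrank ℝ F : ℝ) - (i : ℕ)) / 2 + τ i) /
          Gamma (((Module.finrank ℝ F : ℝ) - (i : ℕ)) / 2))) := by
  induction m with
  | zero => simp [hwVector, volume_pi]
  | succ m ih =>
    have hmp := volume_preserving_piFinSuccAbove (fun _ : Fin (m + 1) => F) (Fin.last m)
    have hmeas : Measurable fun v : Fin (m + 1) → F =>
        ENNReal.ofReal (exp (-∑ i, ‖v i‖ ^ 2)) * ENNReal.ofReal (hwVector τ (gram ℝ v)) :=
      Measurable.mul (by fun_prop) (measurable_hwVector_gram τ).ennreal_ofReal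
    have hmeas' := hmeas.comp (MeasurableEquiv.piFinSuccAbove
      (fun _ : Fin (m + 1) => F) (Fin.last m)).symm.measurable
    rw [← (hmp.symm _).lintegral_comp hmeas, Measure.volume_eq_prod]
    refine (lintegral_prod_symm _ hmeas'.aemeasurable).trans ?_
    rw [Fin.prod_univ_castSucc, ENNReal.ofReal_mul]
    swap
    · refine Finset.prod_nonneg fun i _ => ?_
      have h1 := Gamma_pos_of_pos (hτ i.castSucc)
      have h2 : (0 : ℝ) < ((Module.finrank ℝ F : ℝ) - (i.castSucc : ℕ)) / 2 := by
        have : ((i.castSucc : ℕ) : ℝ) < Module.finrank ℝ F := by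
          exact_mod_cast (Fin.is_lt i.castSucc).trans_le hm
        linarith
      have h3 := Gamma_pos_of_pos h2
      positivity
    have hih := ih (by omega) (τ ∘ Fin.castSucc) (fun i => hτ i.castSucc)
    simp only [Function.comp_apply] at hih
    simp only [Fin.val_castSucc]
    have hm' : Measurable fun v : Fin m → F => ENNReal.ofReal (exp (-∑ i, ‖v i‖ ^ 2)) *
        ENNReal.ofReal (hwVector (τ ∘ Fin.castSucc) (gram ℝ v)) :=
      Measurable.mul (by fun_prop) (measurable_hwVector_gram _).ennreal_ofReal
    rw [← hih, ← lintegral_mul_const _ hm']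
    refine lintegral_congr_ae ?_
    filter_upwards [ae_linearIndependent (F := F) (m := m) (by omega)] with v hv
    have hrank : Module.finrank ℝ (Submodule.span ℝ (Set.range v)) = m := by
      rw [finrank_span_eq_card hv, Fintype.card_fin]
    have hV : Submodule.span ℝ (Set.range v) ≠ ⊤ := fun h => by
      rw [h, finrank_top] at hrank
      omega
    have hcol := lintegral_exp_neg_norm_sq_mul_orthogonal_rpow _ (t := τ (Fin.last m)) hV
      (by rw [hrank]; exact hτ (Fin.last m))
    rw [hrank] at hcol
    rw [Fin.val_last, ← hcol, ← lintegral_const_mul _ (by fun_prop)]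
    refine lintegral_congr fun x => ?_
    have hsnoc : (MeasurableEquiv.piFinSuccAbove (fun _ : Fin (m + 1) => F) (Fin.last m)).symm
        (x, v) = Fin.snoc v x := Fin.insertNth_last' x v
    have hgram : 0 ≤ hwVector (τ ∘ Fin.castSucc) (gram ℝ v) :=
      hwVector_nonneg _ (posSemidef_gram ℝ v)
    dsimp only [Function.comp_apply]
    rw [hsnoc, hwVector_gram_snoc τ hv x, Fin.sum_univ_castSucc]
    simp only [Fin.snoc_castSucc, Fin.snoc_last]
    rw [neg_add, exp_add, ENNReal.ofReal_mul (exp_pos _).le, ENNReal.ofReal_mul hgram,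
      ENNReal.ofReal_mul (exp_pos _).le]
    ring

theorem lintegral_pearsonII_hwVector {F : Type*} [NormedAddCommGroup F] [InnerProductSpace ℝ F]
    [FiniteDimensional ℝ F] [MeasurableSpace F] [BorelSpace F] {m : ℕ}
    (hm : m ≤ Module.finrank ℝ F) (τ : Fin m → ℝ)
    (hτ : ∀ i : Fin m, 0 < ((Module.finrank ℝ F : ℝ) - (i : ℕ)) / 2 + τ i) {a : ℝ} (ha : 0 < a)
    (hb : 0 < (m * Module.finrank ℝ F : ℝ) / 2 + ∑ i, τ i + a) :
    ∫⁻ v in {v : Fin m → F | ∑ i, ‖v i‖ ^ 2 < 1},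
        ENNReal.ofReal ((1 - ∑ i, ‖v i‖ ^ 2) ^ (a - 1)) *
          ENNReal.ofReal (hwVector τ (gram ℝ v)) =
      ENNReal.ofReal (Gamma a * (∏ i : Fin m, (π ^ ((Module.finrank ℝ F : ℝ) / 2) *
        Gamma (((Module.finrank ℝ F : ℝ) - (i : ℕ)) / 2 + τ i) /
          Gamma (((Module.finrank ℝ F : ℝ) - (i : ℕ)) / 2))) /
            Gamma ((m * Module.finrank ℝ F : ℝ) / 2 + ∑ i, τ i + a)) := by
  have hfin : (Module.finrank ℝ (Fin m → F) : ℝ) = m * Module.finrank ℝ F := by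
    rw [Module.finrank_pi_fintype]; simp
  have key := lintegral_ball_of_homogeneous (volume : Measure (Fin m → F))
    (Q := fun v => ∑ i, ‖v i‖ ^ 2) (by fun_prop)
    (fun v => Finset.sum_nonneg fun i _ => sq_nonneg _)
    (fun c v hc => by
      simp only [Pi.smul_apply, norm_smul, mul_pow, Finset.mul_sum, norm_eq_abs, sq_abs])
    (measurable_hwVector_gram τ).ennreal_ofReal (s := ∑ i, τ i)
    (fun c v hc => by
      have hg : gram ℝ (c • v) = c ^ 2 • gram ℝ v := by
        ext i j
        simp only [gram_apply, Pi.smul_apply, inner_smul_left, inner_smul_right, Matrix.smul_apply,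
          smul_eq_mul, conj_trivial]
        ring
      rw [hg, hwVector_smul τ (posSemidef_gram ℝ v) (by positivity), ENNReal.ofReal_mul
        (by positivity), ← rpow_natCast, ← rpow_mul hc.le]
      norm_num) ha (by rwa [hfin])
  have hΓ := Gamma_pos_of_pos hb
  rw [hfin, lintegral_gaussian_hwVector hm τ hτ, ← ENNReal.ofReal_mul (Gamma_pos_of_pos ha).le]
    at key
  rw [ENNReal.ofReal_div_of_pos hΓ, key, mul_comm, ENNReal.mul_div_cancel_right]
  · exact (ENNReal.ofReal_pos.2 hΓ).ne'
  · exact ENNReal.ofReal_ne_top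

theorem volume_preserving_columns (n m : ℕ) :
    MeasurePreserving (fun (R : Matrix (Fin n) (Fin m) ℝ) (j : Fin m) =>
      (WithLp.toLp 2 fun i => R i j : EuclideanSpace ℝ (Fin n))) :=
  (volume_preserving_pi fun _ : Fin m => PiLp.volume_preserving_toLp (Fin n)).comp
    (volume_preserving_swap (Fin n) (Fin m) ℝ)

theorem gram_columns {n m : ℕ} (R : Matrix (Fin n) (Fin m) ℝ) :
    gram ℝ (fun j : Fin m => (WithLp.toLp 2 fun i => R i j : EuclideanSpace ℝ (Fin n))) =
      Rᵀ * R := by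
  ext i j
  simp [gram_apply, PiLp.inner_apply, mul_apply, mul_comm]

theorem sum_norm_sq_columns {n m : ℕ} (R : Matrix (Fin n) (Fin m) ℝ) :
    ∑ j, ‖(WithLp.toLp 2 fun i => R i j : EuclideanSpace ℝ (Fin n))‖ ^ 2 = (Rᵀ * R).trace := by
  rw [← gram_columns]
  simp only [trace, diag_apply, gram_apply, real_inner_self_eq_norm_sq]

/-- Normalization of the standardized matrix multivariate Pearson type II-Riesz density
(Theorem 3.1, β = 1): for `n ≥ m ≥ 1`, `ν/2 + k > 0`, `t_1 ≥ … ≥ t_m` and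
`n/2 > (m−1)/2 − t_m`,
`∫_{tr(RᵀR) < 1} (1 − tr(RᵀR))^{ν/2+k−1} q_τ(RᵀR) dR
  = π^{mn/2} Γ_m(n/2, τ) Γ(ν/2+k) / (Γ_m(n/2) Γ((ν+mn)/2 + k + Σᵢ tᵢ))`. -/
theorem pearsonII_riesz_density_normalization {n m : ℕ} (hm : 1 ≤ m) (hnm : m ≤ n)
    (ν k : ℝ) (hνk : 0 < ν / 2 + k) (τ : Fin m → ℝ) (hτ : Antitone τ)
    (hn : ((m : ℝ) - 1) / 2 - τ ⟨m - 1, by omega⟩ < (n : ℝ) / 2) :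
    ∫ R in {R : Matrix (Fin n) (Fin m) ℝ | (Rᵀ * R).trace < 1},
        (1 - (Rᵀ * R).trace) ^ (ν / 2 + k - 1) * hwVector τ (Rᵀ * R) =
      π ^ ((m : ℝ) * n / 2) * mvGammaW ((n : ℝ) / 2) τ * Gamma (ν / 2 + k) /
        (mvGamma m ((n : ℝ) / 2) * Gamma ((ν + m * n) / 2 + k + ∑ i, τ i)) := by
  have hnm' : (m : ℝ) ≤ n := by exact_mod_cast hnm
  have hpos : ∀ i : Fin m, 0 < ((n : ℝ) - (i : ℕ)) / 2 + τ i := fun i => by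
    have h1 : τ ⟨m - 1, by omega⟩ ≤ τ i := hτ (Fin.le_def.2 (by simp only; omega))
    have h2 : ((i : ℕ) : ℝ) + 1 ≤ m := by exact_mod_cast i.is_lt
    linarith
  have hpos' : ∀ i : Fin m, 0 < ((n : ℝ) - (i : ℕ)) / 2 := fun i => by
    have h2 : ((i : ℕ) : ℝ) + 1 ≤ m := by exact_mod_cast i.is_lt
    linarith
  have hb : 0 < (m * n : ℝ) / 2 + ∑ i, τ i + (ν / 2 + k) := by
    have h : (0 : ℝ) ≤ ∑ i : Fin m, ((n : ℝ) / 2 + τ i) := Finset.sum_nonneg fun i _ => by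
      have := hpos i
      have h2 : (0 : ℝ) ≤ ((i : ℕ) : ℝ) := Nat.cast_nonneg _
      linarith
    rw [Finset.sum_add_distrib, Finset.sum_const, Finset.card_univ, Fintype.card_fin,
      nsmul_eq_mul] at h
    linarith
  have hdim : Module.finrank ℝ (EuclideanSpace ℝ (Fin n)) = n := finrank_euclideanSpace_fin
  set a := ν / 2 + k with ha
  set G : (Fin m → EuclideanSpace ℝ (Fin n)) → ℝ := fun v =>
    (1 - ∑ i, ‖v i‖ ^ 2) ^ (a - 1) * hwVector τ (gram ℝ v) with hG
  have hGm : Measurable G := Measurable.mul (by fun_prop) (measurable_hwVector_gram τ)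
  set e : Matrix (Fin n) (Fin m) ℝ → Fin m → EuclideanSpace ℝ (Fin n) := fun R j =>
    WithLp.toLp 2 fun i => R i j with he
  have hmp : MeasurePreserving e := volume_preserving_columns n m
  set S : Set (Fin m → EuclideanSpace ℝ (Fin n)) := {v | ∑ i, ‖v i‖ ^ 2 < 1} with hS
  have hSm : MeasurableSet S := measurableSet_lt (by fun_prop) measurable_const
  have hGe : ∀ R, (1 - (Rᵀ * R).trace) ^ (a - 1) * hwVector τ (Rᵀ * R) = G (e R) := fun R => by
    simp only [hG, he, gram_columns, sum_norm_sq_columns]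
  have hSe : {R : Matrix (Fin n) (Fin m) ℝ | (Rᵀ * R).trace < 1} = e ⁻¹' S := by
    ext R
    simp only [hS, he, Set.mem_preimage, Set.mem_ofPred_eq, sum_norm_sq_columns]
  have hG0 : ∀ v ∈ S, 0 ≤ G v := fun v hv =>
    mul_nonneg (rpow_nonneg (sub_nonneg.2 (le_of_lt hv)) _)
      (hwVector_nonneg _ (posSemidef_gram ℝ v))
  have hmpS : MeasurePreserving e (volume.restrict (e ⁻¹' S)) (volume.restrict S) :=
    hmp.restrict_preimage hSm
  have key := lintegral_pearsonII_hwVector (F := EuclideanSpace ℝ (Fin n)) (by rwa [hdim]) τ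
    (by rwa [hdim]) hνk (by rwa [hdim])
  have hlin : ∫⁻ v in S, ENNReal.ofReal (G v) = ∫⁻ v in S,
      ENNReal.ofReal ((1 - ∑ i, ‖v i‖ ^ 2) ^ (a - 1)) * ENNReal.ofReal (hwVector τ (gram ℝ v)) :=
    setLIntegral_congr_fun hSm fun v hv =>
      ENNReal.ofReal_mul (rpow_nonneg (sub_nonneg.2 (le_of_lt hv)) _)
  have hΓ : ∀ i : Fin m, 0 < Gamma (((n : ℝ) - (i : ℕ)) / 2) := fun i => Gamma_pos_of_pos (hpos' i)
  have hΓ' : ∀ i : Fin m, 0 < Gamma (((n : ℝ) - (i : ℕ)) / 2 + τ i) := fun i =>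
    Gamma_pos_of_pos (hpos i)
  have hΓa := Gamma_pos_of_pos hνk
  have hΓb := Gamma_pos_of_pos hb
  have hnonneg : 0 ≤ᵐ[volume.restrict (e ⁻¹' S)] fun R => G (e R) := by
    filter_upwards [ae_restrict_mem (hmp.measurable hSm)] with R hR using hG0 _ hR
  have hmeas : AEStronglyMeasurable (fun R => G (e R)) (volume.restrict (e ⁻¹' S)) :=
    (hGm.comp hmp.measurable).aestronglyMeasurable
  simp_rw [hGe, hSe]
  rw [integral_eq_lintegral_of_nonneg_ae hnonneg hmeas,
    hmpS.lintegral_comp hGm.ennreal_ofReal, hlin, key, hdim, ENNReal.toReal_ofReal]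
  · have h1 : ∀ i : Fin m, (n : ℝ) / 2 + τ i - (i : ℕ) / 2 = ((n : ℝ) - (i : ℕ)) / 2 + τ i :=
      fun i => by ring
    have h2 : ∀ i : Fin m, (n : ℝ) / 2 - (i : ℕ) / 2 = ((n : ℝ) - (i : ℕ)) / 2 :=
      fun i => by ring
    have h3 : (π ^ ((n : ℝ) / 2)) ^ m = π ^ ((m : ℝ) * n / 2) := by
      rw [← rpow_natCast, ← rpow_mul pi_pos.le]
      congr 1
      ring
    have h4 : (ν + m * n) / 2 + k + ∑ i, τ i = (m * n : ℝ) / 2 + ∑ i, τ i + a := by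
      rw [ha]; ring
    simp only [mvGammaW, mvGamma, h1, h2, h4, Finset.prod_div_distrib, Finset.prod_mul_distrib,
      Finset.prod_const, Finset.card_univ, Fintype.card_fin, h3]
    have hprod := (Finset.prod_pos fun i (_ : i ∈ Finset.univ) => hΓ i).ne'
    have hπ := (rpow_pos_of_pos pi_pos ((m : ℝ) * ((m : ℝ) - 1) / 4)).ne'
    field_simp
  · have h : 0 ≤ ∏ i : Fin m, (π ^ ((n : ℝ) / 2) * Gamma (((n : ℝ) - (i : ℕ)) / 2 + τ i) /
        Gamma (((n : ℝ) - (i : ℕ)) / 2)) := Finset.prod_nonneg fun i _ => by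
      have := hΓ i
      have := hΓ' i
      positivity
    positivity
end

section
/- Let m ≥ 1 and let a be a real number with a > m − 1. Then ∫_{{H : H m×m complex Hermitian positive definite}} exp(−tr H) (det H)^{a−m} dH = π^{m(m−1)/2} ∏_{i=1}^m Γ(a − (i−1)), where the integral is with respect to the Lebesgue measure on the space of m×m complex Hermitian matrices given by the real diagonal entries and the real and imaginary parts of the above-diagonal entries. -/
open MeasureTheory Matrix Real
open scoped ComplexOrder

/-- Lebesgue measure on the space of `m × m` complex Hermitian matrices, given by the real
diagonal entries and the real and imaginary parts of the above-diagonal entries. -/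
noncomputable def hermMeasure (m : ℕ) : Measure (Matrix (Fin m) (Fin m) ℂ) :=
  Measure.map
    (fun fd : ({p : Fin m × Fin m // p.1 < p.2} → ℂ) × (Fin m → ℝ) =>
      Matrix.of fun i j =>
        if h : i < j then fd.1 ⟨(i, j), h⟩
        else if h' : j < i then star (fd.1 ⟨(j, i), h'⟩)
        else (fd.2 i : ℂ))
    volume

/-- The matrix with corner entry `h`, rest of the first row `v`, rest of the first column `star v`
and lower right block `M`. -/
def bordered {m : ℕ} (h : ℝ) (v : Fin m → ℂ) (M : Matrix (Fin m) (Fin m) ℂ) :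
    Matrix (Fin (m + 1)) (Fin (m + 1)) ℂ :=
  Matrix.of (Fin.cons (Fin.cons (h : ℂ) v) fun i => Fin.cons (star (v i)) (M i))

/-- The rank one correction by which the lower right block of a bordered matrix differs from its
Schur complement. -/
noncomputable def schurCorrection {m : ℕ} (h : ℝ) (v : Fin m → ℂ) : Matrix (Fin m) (Fin m) ℂ :=
  (h : ℂ)⁻¹ • vecMulVec (star v) v

/-- Splitting off the first index. -/
def unitSumFinEquiv (m : ℕ) : Unit ⊕ Fin m ≃ Fin (m + 1) :=
  ((Equiv.sumComm _ _).trans (Equiv.optionEquivSumPUnit (Fin m)).symm).trans (finSuccEquiv m).symm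

lemma bordered_submatrix {m : ℕ} (h : ℝ) (v : Fin m → ℂ) (M : Matrix (Fin m) (Fin m) ℂ) :
    (bordered h v M).submatrix (unitSumFinEquiv m) (unitSumFinEquiv m) =
      fromBlocks (diagonal fun _ => (h : ℂ)) (replicateRow Unit v) (replicateRow Unit v)ᴴ M := by
  ext i j
  rcases i with _ | i <;> rcases j with _ | j <;>
    simp [bordered, unitSumFinEquiv]

lemma schurCorrection_eq {m : ℕ} (h : ℝ) (v : Fin m → ℂ) :
    (replicateRow Unit v)ᴴ * (diagonal fun _ : Unit => (h : ℂ))⁻¹ * replicateRow Unit v =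
      schurCorrection h v := by
  ext i j
  simp [schurCorrection, Matrix.mul_apply, vecMulVec_apply]
  ring

lemma isHermitian_schurCorrection {m : ℕ} (h : ℝ) (v : Fin m → ℂ) :
    (schurCorrection h v).IsHermitian := by
  ext i j
  simp [schurCorrection, vecMulVec_apply, mul_comm (v _)]

lemma det_bordered {m : ℕ} {h : ℝ} (hh : h ≠ 0) (v : Fin m → ℂ) (M : Matrix (Fin m) (Fin m) ℂ) :
    (bordered h v M).det = h * (M - schurCorrection h v).det := by
  have hd : IsUnit (diagonal fun _ : Unit => (h : ℂ)) := by
    simp [Matrix.isUnit_iff_isUnit_det, hh]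
  let _ := hd.invertible
  rw [← det_submatrix_equiv_self (unitSumFinEquiv m), bordered_submatrix, det_fromBlocks₁₁,
    invOf_eq_nonsing_inv, schurCorrection_eq]
  simp

lemma trace_bordered {m : ℕ} (h : ℝ) (v : Fin m → ℂ) (M : Matrix (Fin m) (Fin m) ℂ) :
    (bordered h v M).trace = h + M.trace := by
  simp [Matrix.trace, Fin.sum_univ_succ, bordered]

lemma trace_schurCorrection {m : ℕ} (h : ℝ) (v : Fin m → ℂ) :
    (schurCorrection h v).trace = ((∑ i, h⁻¹ * ‖v i‖ ^ 2 : ℝ) : ℂ) := by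
  simp [schurCorrection, Matrix.trace, vecMulVec_apply, Complex.conj_mul']

lemma posDef_iff_posSemidef_and_det_ne_zero {m : ℕ} (A : Matrix (Fin m) (Fin m) ℂ) :
    A.PosDef ↔ A.PosSemidef ∧ A.det ≠ 0 :=
  ⟨fun hA => ⟨hA.posSemidef, hA.det_pos.ne'⟩, fun hA => hA.1.posDef_iff_det_ne_zero.2 hA.2⟩

lemma posDef_bordered_iff {m : ℕ} (h : ℝ) (v : Fin m → ℂ) (M : Matrix (Fin m) (Fin m) ℂ) :
    (bordered h v M).PosDef ↔ 0 < h ∧ (M - schurCorrection h v).PosDef := by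
  by_cases hh : 0 < h
  · have hd : (diagonal fun _ : Unit => (h : ℂ)).PosDef :=
      PosDef.diagonal fun _ => by simpa using hh
    let _ := hd.isUnit.invertible
    have hs : (bordered h v M).PosSemidef ↔ (M - schurCorrection h v).PosSemidef := by
      rw [← posSemidef_submatrix_equiv (unitSumFinEquiv m), bordered_submatrix,
        PosDef.fromBlocks₁₁ _ _ hd, schurCorrection_eq]
    rw [posDef_iff_posSemidef_and_det_ne_zero, posDef_iff_posSemidef_and_det_ne_zero, hs,
      det_bordered hh.ne']
    simp [hh, hh.ne']
  · refine ⟨fun H => absurd ?_ hh, fun H => absurd H.1 hh⟩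
    simpa [bordered] using H.diag_pos (i := 0)

lemma measurableSet_posDef (m : ℕ) : MeasurableSet {H : Matrix (Fin m) (Fin m) ℂ | H.PosDef} := by
  have : BorelSpace (Matrix (Fin m) (Fin m) ℂ) := inferInstanceAs (BorelSpace (Fin m → Fin m → ℂ))
  have h1 : {H : Matrix (Fin m) (Fin m) ℂ | H.PosDef} =
      ({H | H.IsHermitian} ∩ ⋂ x : Fin m → ℂ, {H | 0 ≤ star x ⬝ᵥ (H *ᵥ x)}) ∩ {H | H.det ≠ 0} := by
    ext H
    simp only [Set.mem_ofPred_eq, Set.mem_inter_iff, Set.mem_iInter]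
    rw [← posSemidef_iff_dotProduct_mulVec, posDef_iff_posSemidef_and_det_ne_zero]
  rw [h1]
  refine (IsClosed.measurableSet (.inter ?_ (isClosed_iInter fun x => ?_))).inter
    (isOpen_ne_fun (by fun_prop) (by fun_prop)).measurableSet
  · exact isClosed_eq (by fun_prop) (by fun_prop)
  · exact isClosed_le (by fun_prop) (by fun_prop)

/-- The parametrization of Hermitian matrices by above-diagonal and diagonal entries. -/
noncomputable def hermParam (m : ℕ)
    (fd : ({p : Fin m × Fin m // p.1 < p.2} → ℂ) × (Fin m → ℝ)) : Matrix (Fin m) (Fin m) ℂ :=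
  Matrix.of fun i j =>
    if h : i < j then fd.1 ⟨(i, j), h⟩
    else if h' : j < i then star (fd.1 ⟨(j, i), h'⟩)
    else (fd.2 i : ℂ)

lemma hermMeasure_eq_map (m : ℕ) : hermMeasure m = Measure.map (hermParam m) volume := rfl

lemma measurable_matrix {α : Type*} [MeasurableSpace α] {m n : ℕ}
    {f : α → Matrix (Fin m) (Fin n) ℂ} (hf : ∀ i j, Measurable fun x => f x i j) : Measurable f :=
  measurable_pi_lambda (fun x => (f x : Fin m → Fin n → ℂ)) fun i => measurable_pi_lambda _ (hf i)

lemma measurable_hermParam (m : ℕ) : Measurable (hermParam m) := by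
  refine measurable_matrix fun i j => ?_
  rcases lt_trichotomy i j with h | h | h
  · simp only [hermParam, of_apply, h, dif_pos]
    fun_prop
  · subst h
    simp only [hermParam, of_apply, lt_irrefl, dif_neg, not_false_eq_true]
    fun_prop
  · simp only [hermParam, of_apply, h, not_lt_of_gt h, dif_neg, dif_pos, not_false_eq_true]
    fun_prop

instance (m : ℕ) : SFinite (hermMeasure m) := by
  rw [hermMeasure_eq_map]
  infer_instance

lemma measurable_matrix_entry {m n : ℕ} (i : Fin m) (j : Fin n) :
    Measurable fun H : Matrix (Fin m) (Fin n) ℂ => H i j :=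
  (measurable_pi_apply j).comp (measurable_pi_apply (X := fun _ : Fin m => Fin n → ℂ) i)

lemma hermMeasure_map_add {m : ℕ} {A : Matrix (Fin m) (Fin m) ℂ} (hA : A.IsHermitian) :
    Measure.map (· + A) (hermMeasure m) = hermMeasure m := by
  have hm : Measurable fun H : Matrix (Fin m) (Fin m) ℂ => H + A :=
    measurable_matrix fun i j => (measurable_matrix_entry i j).add_const (A i j)
  set x : ({p : Fin m × Fin m // p.1 < p.2} → ℂ) × (Fin m → ℝ) :=
    (fun p => A p.1.1 p.1.2, fun i => (A i i).re) with hx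
  have h : (· + A) ∘ hermParam m = hermParam m ∘ (· + x) := by
    ext fd i j
    simp only [Function.comp_apply, Matrix.add_apply, hermParam, of_apply, hx, Prod.fst_add,
      Prod.snd_add, Pi.add_apply]
    split_ifs with h₁ h₂
    · rfl
    · rw [star_add, hA.apply]
    · obtain rfl : i = j := le_antisymm (not_lt.1 h₂) (not_lt.1 h₁)
      rw [Complex.ofReal_add]
      congr 1
      exact (Complex.conj_eq_iff_re.1 (hA.apply i i)).symm
  have : (volume : Measure (({p : Fin m × Fin m // p.1 < p.2} → ℂ) ×
      (Fin m → ℝ))).IsAddLeftInvariant := Measure.prod.instIsAddLeftInvariant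
  rw [hermMeasure_eq_map, Measure.map_map hm (measurable_hermParam m), h,
    ← Measure.map_map (measurable_hermParam m) (by fun_prop), map_add_right_eq_self]

/-- Above-diagonal positions of an `(m + 1) × (m + 1)` matrix: either in the first row, or
above-diagonal positions of the lower right `m × m` block. -/
noncomputable def upperSuccEquiv (m : ℕ) : Fin m ⊕ {p : Fin m × Fin m // p.1 < p.2} ≃
    {p : Fin (m + 1) × Fin (m + 1) // p.1 < p.2} :=
  Equiv.ofBijective
    (Sum.elim (fun j => ⟨(0, j.succ), j.succ_pos⟩)
      fun p => ⟨(p.1.1.succ, p.1.2.succ), Fin.succ_lt_succ_iff.2 p.2⟩) <| by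
    constructor
    · rintro (i | ⟨⟨i, j⟩, hi⟩) (k | ⟨⟨k, l⟩, hk⟩) h <;> simp_all [Fin.ext_iff]
    · rintro ⟨⟨i, j⟩, h⟩
      induction j using Fin.cases with
      | zero => exact absurd h (Fin.not_lt_zero _)
      | succ j =>
        induction i using Fin.cases with
        | zero => exact ⟨.inl j, rfl⟩
        | succ i => exact ⟨.inr ⟨(i, j), Fin.succ_lt_succ_iff.1 h⟩, rfl⟩

lemma exists_measurePreserving_hermParam_succ (m : ℕ) :
    ∃ e : ℝ × (Fin m → ℂ) × ({p : Fin m × Fin m // p.1 < p.2} → ℂ) × (Fin m → ℝ) →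
        ({p : Fin (m + 1) × Fin (m + 1) // p.1 < p.2} → ℂ) × (Fin (m + 1) → ℝ),
      MeasurePreserving e volume volume ∧
        ∀ x, hermParam (m + 1) (e x) = bordered x.1 x.2.1 (hermParam m x.2.2) := by
  let I := {p : Fin m × Fin m // p.1 < p.2}
  let u := MeasurableEquiv.piCongrLeft (fun _ => ℂ) (upperSuccEquiv m)
  let s := (MeasurableEquiv.sumPiEquivProdPi fun _ : Fin m ⊕ I => ℂ).symm
  let c := (MeasurableEquiv.piFinSuccAbove (fun _ : Fin (m + 1) => ℝ) 0).symm
  have hu : MeasurePreserving (u ∘ s) volume volume :=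
    (volume_measurePreserving_piCongrLeft _ _).comp
      (volume_measurePreserving_sumPiEquivProdPi_symm _)
  have hc : MeasurePreserving c volume volume :=
    (volume_preserving_piFinSuccAbove (fun _ : Fin (m + 1) => ℝ) 0).symm
  have h1 : MeasurePreserving (fun x : ℝ × (Fin m → ℂ) × (I → ℂ) × (Fin m → ℝ) =>
      (((x.2.1, x.2.2.1), (x.1, x.2.2.2)) : ((Fin m → ℂ) × (I → ℂ)) × (ℝ × (Fin m → ℝ))))
      volume volume := by
    have a1 := (MeasurePreserving.id (volume : Measure ℝ)).prod
      (volume_preserving_prodAssoc (α₁ := Fin m → ℂ) (β₁ := I → ℂ) (γ₁ := Fin m → ℝ)).symm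
    have a2 := (MeasurePreserving.id (volume : Measure ℝ)).prod
      (Measure.measurePreserving_swap (μ := (volume : Measure ((Fin m → ℂ) × (I → ℂ))))
        (ν := (volume : Measure (Fin m → ℝ))))
    have a3 := (volume_preserving_prodAssoc (α₁ := ℝ) (β₁ := Fin m → ℝ)
      (γ₁ := (Fin m → ℂ) × (I → ℂ))).symm
    have a4 := Measure.measurePreserving_swap (μ := (volume : Measure (ℝ × (Fin m → ℝ))))
        (ν := (volume : Measure ((Fin m → ℂ) × (I → ℂ))))
    exact a4.comp (a3.comp (a2.comp a1))
  refine ⟨_, (hu.prod hc).comp h1, fun ⟨h, v, f, d⟩ => ?_⟩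
  have hu0 : ∀ (j : Fin m) hj, u (s (v, f)) ⟨(0, j.succ), hj⟩ = v j := fun j hj =>
    Equiv.piCongrLeft_apply_apply (fun _ => ℂ) (upperSuccEquiv m) (s (v, f)) (.inl j)
  have hus : ∀ (i j : Fin m) (hij : i < j) hj, u (s (v, f)) ⟨(i.succ, j.succ), hj⟩ =
      f ⟨(i, j), hij⟩ := fun i j hij hj =>
    Equiv.piCongrLeft_apply_apply (fun _ => ℂ) (upperSuccEquiv m) (s (v, f)) (.inr ⟨(i, j), hij⟩)
  have hc0 : c (h, d) 0 = h := rfl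
  have hcs : ∀ i : Fin m, c (h, d) i.succ = d i := fun i => rfl
  ext i j
  induction i using Fin.cases with
  | zero =>
    induction j using Fin.cases with
    | zero => simp [hermParam, bordered, hc0]
    | succ j => simp [hermParam, bordered, hu0]
  | succ i =>
    induction j using Fin.cases with
    | zero => simp [hermParam, bordered, hu0]
    | succ j =>
      rcases lt_trichotomy i j with h | rfl | h
      · simp [hermParam, bordered, h, hus i j h]
      · simp [hermParam, bordered, hcs]
      · simp [hermParam, bordered, h, not_lt_of_gt h, hus j i h]

lemma measurable_bordered (m : ℕ) :
    Measurable fun x : ℝ × (Fin m → ℂ) × Matrix (Fin m) (Fin m) ℂ =>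
      bordered x.1 x.2.1 x.2.2 := by
  have h : Measurable fun x : ℝ × (Fin m → ℂ) × Matrix (Fin m) (Fin m) ℂ => x.2.2 := by fun_prop
  have h' : ∀ i j, Measurable fun x : ℝ × (Fin m → ℂ) × Matrix (Fin m) (Fin m) ℂ => x.2.2 i j :=
    fun i j => (measurable_matrix_entry i j).comp h
  refine measurable_matrix fun i j => ?_
  induction i using Fin.cases <;> induction j using Fin.cases <;> simp [bordered] <;> fun_prop

lemma hermMeasure_succ (m : ℕ) :
    hermMeasure (m + 1) =
      Measure.map (fun x : ℝ × (Fin m → ℂ) × Matrix (Fin m) (Fin m) ℂ => bordered x.1 x.2.1 x.2.2)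
        ((volume : Measure ℝ).prod ((volume : Measure (Fin m → ℂ)).prod (hermMeasure m))) := by
  obtain ⟨e, he, hp⟩ := exists_measurePreserving_hermParam_succ m
  have h2 : (volume : Measure (Fin m → ℂ)).prod (hermMeasure m) =
      Measure.map (Prod.map id (hermParam m)) volume := by
    rw [hermMeasure_eq_map]
    conv_lhs => rw [← Measure.map_id (μ := (volume : Measure (Fin m → ℂ)))]
    exact Measure.map_prod_map _ _ measurable_id (measurable_hermParam m)
  have h3 : (volume : Measure ℝ).prod ((volume : Measure (Fin m → ℂ)).prod (hermMeasure m)) =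
      Measure.map (Prod.map id (Prod.map id (hermParam m))) volume := by
    rw [h2]
    conv_lhs => rw [← Measure.map_id (μ := (volume : Measure ℝ))]
    exact Measure.map_prod_map _ _ measurable_id (measurable_id.prodMap (measurable_hermParam m))
  rw [h3, Measure.map_map (measurable_bordered m)
    (measurable_id.prodMap (measurable_id.prodMap (measurable_hermParam m))),
    hermMeasure_eq_map, ← he.map_eq, Measure.map_map (measurable_hermParam _) he.measurable]
  congr 1
  exact funext hp

/-- The integrand of the multivariate Gamma integral, extended by zero off the positive definite
cone. -/
noncomputable def gammaDensity (m : ℕ) (s : ℝ) : Matrix (Fin m) (Fin m) ℂ → ENNReal :=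
  {H | H.PosDef}.indicator fun H => ENNReal.ofReal (Real.exp (-H.trace.re) * H.det.re ^ s)

lemma measurable_exp_trace_mul_det_rpow (m : ℕ) (s : ℝ) :
    Measurable fun H : Matrix (Fin m) (Fin m) ℂ => Real.exp (-H.trace.re) * H.det.re ^ s := by
  have : BorelSpace (Matrix (Fin m) (Fin m) ℂ) := inferInstanceAs (BorelSpace (Fin m → Fin m → ℂ))
  have h1 : Measurable fun H : Matrix (Fin m) (Fin m) ℂ => H.trace.re :=
    (Complex.continuous_re.comp (by fun_prop)).measurable
  have h2 : Measurable fun H : Matrix (Fin m) (Fin m) ℂ => H.det.re :=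
    (Complex.continuous_re.comp (by fun_prop)).measurable
  exact h1.neg.exp.mul (h2.pow_const s)

lemma measurable_gammaDensity (m : ℕ) (s : ℝ) : Measurable (gammaDensity m s) :=
  (measurable_exp_trace_mul_det_rpow m s).ennreal_ofReal.indicator (measurableSet_posDef m)

lemma det_re_pos {m : ℕ} {H : Matrix (Fin m) (Fin m) ℂ} (hH : H.PosDef) : 0 < H.det.re :=
  (Complex.pos_iff.1 hH.det_pos).1

lemma gammaDensity_bordered {m : ℕ} (s : ℝ) {h : ℝ} (hh : 0 < h) (v : Fin m → ℂ)
    (M : Matrix (Fin m) (Fin m) ℂ) :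
    gammaDensity (m + 1) s (bordered h v (M + schurCorrection h v)) =
      ENNReal.ofReal (Real.exp (-h) * h ^ s) *
        (ENNReal.ofReal (∏ i, Real.exp (-h⁻¹ * ‖v i‖ ^ 2)) * gammaDensity m s M) := by
  by_cases hM : M.PosDef
  · have hB : (bordered h v (M + schurCorrection h v)).PosDef := by
      rw [posDef_bordered_iff, add_sub_cancel_right]
      exact ⟨hh, hM⟩
    rw [gammaDensity, gammaDensity, Set.indicator_of_mem (by exact hB),
      Set.indicator_of_mem (by exact hM), ← ENNReal.ofReal_mul (by positivity),
      ← ENNReal.ofReal_mul (by positivity), det_bordered hh.ne', trace_bordered,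
      Matrix.trace_add, trace_schurCorrection, add_sub_cancel_right, Complex.re_ofReal_mul,
      Real.mul_rpow hh.le (det_re_pos hM).le, ← Real.exp_sum]
    simp only [Complex.add_re, Complex.ofReal_re, neg_add, Real.exp_add, neg_mul,
      Finset.sum_neg_distrib]
    ring_nf
  · have hB : ¬ (bordered h v (M + schurCorrection h v)).PosDef := by
      rw [posDef_bordered_iff, add_sub_cancel_right]
      exact fun h => hM h.2
    rw [gammaDensity, gammaDensity, Set.indicator_of_notMem (by exact hB),
      Set.indicator_of_notMem (by exact hM), mul_zero, mul_zero]

lemma gammaDensity_bordered_of_nonpos {m : ℕ} (s : ℝ) {h : ℝ} (hh : ¬ 0 < h) (v : Fin m → ℂ)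
    (M : Matrix (Fin m) (Fin m) ℂ) : gammaDensity (m + 1) s (bordered h v M) = 0 := by
  have hB : ¬ (bordered h v M).PosDef := fun H => hh ((posDef_bordered_iff h v M).1 H).1
  rw [gammaDensity, Set.indicator_of_notMem (by exact hB)]

lemma lintegral_prod_exp_neg_mul_norm_sq (m : ℕ) {b : ℝ} (hb : 0 < b) :
    ∫⁻ v : Fin m → ℂ, ENNReal.ofReal (∏ i, Real.exp (-b * ‖v i‖ ^ 2)) =
      ENNReal.ofReal ((π / b) ^ m) := by
  have h1 : ∫ z : ℂ, Real.exp (-b * ‖z‖ ^ 2) = π / b := by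
    rw [GaussianFourier.integral_rexp_neg_mul_sq_norm hb]
    simp
  have h2 : Integrable fun z : ℂ => Real.exp (-b * ‖z‖ ^ 2) := by
    refine not_imp_comm.1 integral_undef ?_
    rw [h1]
    positivity
  have h3 : Integrable fun v : Fin m → ℂ => ∏ i, Real.exp (-b * ‖v i‖ ^ 2) :=
    Integrable.fintype_prod fun _ => h2
  rw [← ofReal_integral_eq_lintegral_ofReal h3
    (ae_of_all _ fun v => by positivity),
    integral_fintype_prod_volume_eq_pow fun z : ℂ => Real.exp (-b * ‖z‖ ^ 2), h1, Fintype.card_fin]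

lemma lintegral_gammaDensity_bordered {m : ℕ} (s : ℝ) {h : ℝ} (hh : 0 < h) :
    ∫⁻ v, ∫⁻ M, gammaDensity (m + 1) s (bordered h v M) ∂(hermMeasure m) =
      ENNReal.ofReal (π ^ m * (Real.exp (-h) * h ^ (s + m))) *
        ∫⁻ M, gammaDensity m s M ∂(hermMeasure m) := by
  have hmeas (v : Fin m → ℂ) : Measurable fun M => gammaDensity (m + 1) s (bordered h v M) :=
    (measurable_gammaDensity _ s).comp ((measurable_bordered m).comp
      (measurable_const.prodMk (measurable_const.prodMk measurable_id)))
  have hadd (A : Matrix (Fin m) (Fin m) ℂ) : Measurable (· + A) :=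
    measurable_matrix fun i j => (measurable_matrix_entry i j).add_const (A i j)
  have h1 (v : Fin m → ℂ) : ∫⁻ M, gammaDensity (m + 1) s (bordered h v M) ∂(hermMeasure m) =
      ENNReal.ofReal (Real.exp (-h) * h ^ s) * (ENNReal.ofReal (∏ i, Real.exp (-h⁻¹ * ‖v i‖ ^ 2)) *
        ∫⁻ M, gammaDensity m s M ∂(hermMeasure m)) := by
    rw [← hermMeasure_map_add (isHermitian_schurCorrection h v),
      lintegral_map (hmeas v) (hadd _)]
    simp_rw [gammaDensity_bordered s hh v]
    rw [lintegral_const_mul _ ((measurable_gammaDensity m s).const_mul _),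
      lintegral_const_mul _ (measurable_gammaDensity m s),
      hermMeasure_map_add (isHermitian_schurCorrection h v)]
  simp_rw [h1]
  have hG : Measurable fun v : Fin m → ℂ =>
      ENNReal.ofReal (∏ i, Real.exp (-h⁻¹ * ‖v i‖ ^ 2)) := by fun_prop
  rw [lintegral_const_mul _ (hG.mul_const _), lintegral_mul_const _ hG,
    lintegral_prod_exp_neg_mul_norm_sq m (inv_pos.2 hh), ← mul_assoc,
    ← ENNReal.ofReal_mul (by positivity), Real.rpow_add hh, Real.rpow_natCast, div_inv_eq_mul,
    mul_pow]
  ring_nf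

lemma lintegral_gammaDensity_succ {m : ℕ} {s : ℝ} (hs : -1 < s) :
    ∫⁻ H, gammaDensity (m + 1) s H ∂(hermMeasure (m + 1)) =
      ENNReal.ofReal (π ^ m * Gamma (s + m + 1)) *
        ∫⁻ H, gammaDensity m s H ∂(hermMeasure m) := by
  have hpos : 0 < s + m + 1 := by
    have : (0 : ℝ) ≤ m := m.cast_nonneg
    linarith
  have hmeas : Measurable fun x : ℝ × (Fin m → ℂ) × Matrix (Fin m) (Fin m) ℂ =>
      gammaDensity (m + 1) s (bordered x.1 x.2.1 x.2.2) :=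
    (measurable_gammaDensity _ s).comp (measurable_bordered m)
  have hsplit (h : ℝ) : ∫⁻ y : (Fin m → ℂ) × Matrix (Fin m) (Fin m) ℂ,
      gammaDensity (m + 1) s (bordered h y.1 y.2) ∂((volume : Measure (Fin m → ℂ)).prod
        (hermMeasure m)) =
      (Set.Ioi (0 : ℝ)).indicator (fun h =>
        ENNReal.ofReal (π ^ m * (Real.exp (-h) * h ^ (s + m))) *
        ∫⁻ M, gammaDensity m s M ∂(hermMeasure m)) h := by
    by_cases hh : 0 < h
    · rw [Set.indicator_of_mem (by exact hh), ← lintegral_gammaDensity_bordered s hh]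
      exact lintegral_prod _ (hmeas.comp (measurable_prodMk_left (x := h))).aemeasurable
    · simp_rw [Set.indicator_of_notMem (show h ∉ Set.Ioi (0 : ℝ) from hh),
        gammaDensity_bordered_of_nonpos s hh, lintegral_zero]
  have hI : IntegrableOn (fun h : ℝ => Real.exp (-h) * h ^ (s + m)) (Set.Ioi 0) := by
    simpa using Real.GammaIntegral_convergent hpos
  rw [hermMeasure_succ, lintegral_map (measurable_gammaDensity _ s) (measurable_bordered m),
    lintegral_prod _ hmeas.aemeasurable]
  simp_rw [hsplit]
  rw [lintegral_indicator measurableSet_Ioi, lintegral_mul_const _ (by fun_prop),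
    ← ofReal_integral_eq_lintegral_ofReal (hI.const_mul _), integral_const_mul,
    Real.Gamma_eq_integral hpos]
  · simp
  · filter_upwards [ae_restrict_mem measurableSet_Ioi] with h hh
    have : (0 : ℝ) < h := hh
    positivity

lemma lintegral_gammaDensity_zero (s : ℝ) :
    ∫⁻ H, gammaDensity 0 s H ∂(hermMeasure 0) = 1 := by
  have h (H : Matrix (Fin 0) (Fin 0) ℂ) : gammaDensity 0 s H = 1 := by
    have hH : H.PosDef := by
      rw [Subsingleton.elim H 1]
      exact .one
    rw [gammaDensity, Set.indicator_of_mem (by exact hH)]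
    simp [Matrix.trace]
  rw [lintegral_congr h, lintegral_one, hermMeasure_eq_map,
    Measure.map_apply (measurable_hermParam 0) .univ, Set.preimage_univ,
    Measure.volume_eq_prod, ← Set.univ_prod_univ, Measure.prod_prod,
    Measure.volume_pi_eq_dirac 0, Measure.volume_pi_eq_dirac 0]
  simp

lemma lintegral_gammaDensity (m : ℕ) {a : ℝ} (ha : (m : ℝ) - 1 < a) :
    ∫⁻ H, gammaDensity m (a - m) H ∂(hermMeasure m) =
      ENNReal.ofReal (π ^ ((m : ℝ) * ((m : ℝ) - 1) / 2) * ∏ i : Fin m, Gamma (a - (i : ℝ))) := by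
  induction m generalizing a with
  | zero => simp [lintegral_gammaDensity_zero]
  | succ m ih =>
    push_cast at ha ⊢
    have hm : (0 : ℝ) ≤ m := m.cast_nonneg
    have hpos : 0 < Gamma a := Gamma_pos_of_pos (by linarith)
    have hexp : ((m : ℝ) + 1) * ((m : ℝ) + 1 - 1) / 2 = m + m * (m - 1) / 2 := by ring
    rw [lintegral_gammaDensity_succ (by linarith),
      show a - (m + 1 : ℝ) + m + 1 = a by ring, sub_add_eq_sub_sub_swap, ih (by linarith),
      ← ENNReal.ofReal_mul (mul_nonneg (by positivity) hpos.le), Fin.prod_univ_succ, hexp,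
      Real.rpow_add Real.pi_pos, Real.rpow_natCast]
    simp only [Fin.val_succ, Fin.val_zero, Nat.cast_add, Nat.cast_one, Nat.cast_zero, sub_zero,
      sub_add_eq_sub_sub_swap]
    ring_nf

/-- The complex (β = 2) multivariate Gamma function as an integral over the cone of
positive definite Hermitian matrices: for `a > m − 1`,
`∫_{H ≻ 0} exp(−tr H) (det H)^{a−m} dH = π^{m(m−1)/2} ∏_{i=1}^m Γ(a − (i−1))`. -/
theorem multivariate_gamma_integral_complex {m : ℕ} (hm : 1 ≤ m) (a : ℝ)
    (ha : (m : ℝ) - 1 < a) :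
    ∫ H in {H : Matrix (Fin m) (Fin m) ℂ | H.PosDef},
        Real.exp (-H.trace.re) * H.det.re ^ (a - (m : ℝ)) ∂(hermMeasure m) =
      π ^ ((m : ℝ) * ((m : ℝ) - 1) / 2) * ∏ i : Fin m, Gamma (a - (i : ℝ)) := by
  have hnonneg : ∀ᵐ H ∂(hermMeasure m).restrict {H : Matrix (Fin m) (Fin m) ℂ | H.PosDef},
      0 ≤ Real.exp (-H.trace.re) * H.det.re ^ (a - (m : ℝ)) := by
    filter_upwards [ae_restrict_mem (measurableSet_posDef m)] with H hH
    have := det_re_pos hH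
    positivity
  have hgamma : ∀ i : Fin m, 0 < Gamma (a - (i : ℝ)) := fun i => by
    have hi : (i : ℝ) + 1 ≤ m := by exact_mod_cast i.isLt
    exact Gamma_pos_of_pos (by linarith)
  rw [integral_eq_lintegral_of_nonneg_ae hnonneg
    (measurable_exp_trace_mul_det_rpow m _).aestronglyMeasurable,
    ← lintegral_indicator (measurableSet_posDef m)]
  exact (congrArg ENNReal.toReal (lintegral_gammaDensity m ha)).trans <| ENNReal.toReal_ofReal <|
    mul_nonneg (by positivity) (Finset.prod_nonneg fun i _ => (hgamma i).le)
end
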